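/- arXiv:2602.02800 — 2 statements merged into one kernel-verified Lean document; each statement's English description precedes it below -/
import Mathlib

section
/- In the setting of the McCann interpolation in the reduced decision space: let α := (w̄*)_#μ, η* ∈ Γ(α,ν) an optimal quadratic-cost coupling, ν_t := (π_t)_#η* and η_t := (Id,π_t)_#η* for t ∈ [0,1]. Define γ_t on measurable rectangles by γ_t(A,B) := Σ_{k=1}^{K} [μ(A ∩ C_k)/μ(C_k)] · η_t({−w_k} × B), where C_k := {x : w*(x) = w_k} and terms with μ(C_k) = 0 are omitted. Then α is supported on {−w_1,…,−w_K} with α({−w_k}) = μ(C_k), γ_t is a coupling in Γ(μ, ν_t), and it satisfies the push-forward identity (w̄* × Id)_#γ_t = η_t; in particular (w̄* × Id)_#γ_1 = η*. -/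
open MeasureTheory Set
open scoped RealInnerProductSpace ENNReal

noncomputable section

/-- `ℝ^d` with the Euclidean inner product. -/
abbrev Vec (d : ℕ) := EuclideanSpace ℝ (Fin d)

/-- `γ` is a coupling of `μ` and `ν`: a measure on the product whose marginals are `μ`, `ν`. -/
def IsCoupling {α β : Type*} [MeasurableSpace α] [MeasurableSpace β]
    (μ : Measure α) (ν : Measure β) (γ : Measure (α × β)) : Prop :=
  γ.map Prod.fst = μ ∧ γ.map Prod.snd = ν

/-- The SPO loss `ℓ_SPO(x,y) = yᵀ w*(x) − yᵀ w*(y)`. -/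
def spoLoss {d : ℕ} (wstar : Vec d → Vec d) (x y : Vec d) : ℝ :=
  ⟪y, wstar x⟫ - ⟪y, wstar y⟫

/-- The optimistic decision-focused distance `W^O_DF(μ,ν) = inf_{γ ∈ Γ(μ,ν)} ∫ ℓ_SPO dγ`. -/
def WDFO {d : ℕ} (wstar : Vec d → Vec d) (μ ν : Measure (Vec d)) : ℝ :=
  sInf {r | ∃ γ : Measure (Vec d × Vec d), IsCoupling μ ν γ ∧
    r = ∫ p, spoLoss wstar p.1 p.2 ∂γ}

/-- The squared quadratic Wasserstein distance `W₂²(P,Q) = inf_{π ∈ Γ(P,Q)} ∫ ‖x−y‖² dπ`. -/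
def W2sq {d : ℕ} (P Q : Measure (Vec d)) : ℝ :=
  sInf {r | ∃ π : Measure (Vec d × Vec d), IsCoupling P Q π ∧
    r = ∫ p, ‖p.1 - p.2‖ ^ 2 ∂π}

/-- The quadratic Wasserstein distance `W₂(P,Q)`. -/
def W2 {d : ℕ} (P Q : Measure (Vec d)) : ℝ := Real.sqrt (W2sq P Q)

/-- The lift of a coupling `η ∈ Γ((w̄*)_#μ, ρ)` back to a coupling of `μ` and `ρ`: on
rectangles, `γ(A × B) = Σ_k [μ(A ∩ C_k)/μ(C_k)] · η({−w_k} × B)`, where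
`C_k = {x : w*(x) = w_k}` and terms with `μ(C_k) = 0` vanish. -/
def liftCoupling {d : ℕ} (𝔖 : Finset (Vec d)) (wstar : Vec d → Vec d)
    (μ : Measure (Vec d)) (η : Measure (Vec d × Vec d)) : Measure (Vec d × Vec d) :=
  ∑ wk ∈ 𝔖, ((μ {x | wstar x = wk})⁻¹ • μ.restrict {x | wstar x = wk}).prod
      ((η.restrict ({-wk} ×ˢ (univ : Set (Vec d)))).map Prod.snd)

lemma sum_restrict_fibers {X Y : Type*} [MeasurableSpace X] [MeasurableSpace Y]
    [MeasurableSingletonClass Y] (m : Measure X) (f : X → Y) (hf : Measurable f)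
    (T : Finset Y) (h : m {x | f x ∉ T} = 0) :
    ∑ k ∈ T, m.restrict (f ⁻¹' {k}) = m := by
  ext s hs
  rw [Measure.finsetSum_apply]
  simp only [Measure.restrict_apply hs]
  rw [← measure_biUnion_finset]
  · apply measure_congr
    have h' : ∀ᵐ x ∂m, f x ∈ T := by
      rw [ae_iff]; exact h
    filter_upwards [h'] with x hx
    apply propext
    constructor
    · intro hx2
      have : x ∈ ⋃ b ∈ T, s ∩ f ⁻¹' {b} := hx2
      simp at this
      exact this.1
    · intro hx2
      have h3 : x ∈ s := hx2
      have : x ∈ ⋃ b ∈ T, s ∩ f ⁻¹' {b} := by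
        simp [h3, hx]
      exact this
  · intro a _ b _ hab
    refine Set.disjoint_left.2 ?_
    rintro x ⟨_, hxa⟩ ⟨_, hxb⟩
    exact hab (hxa.symm.trans hxb)
  · intro k _
    exact hs.inter (hf (measurableSet_singleton k))

lemma lift_props {d : ℕ} (T : Finset (Vec d)) (w : Vec d → Vec d)
    (hw : Measurable w) (hm : ∀ x, w x ∈ T) (μ : Measure (Vec d)) [IsProbabilityMeasure μ]
    (η : Measure (Vec d × Vec d)) (hη : η.map Prod.fst = μ.map (fun x => -w x)) :
    (liftCoupling T w μ η).map Prod.fst = μ ∧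
    (liftCoupling T w μ η).map (fun q => (-w q.1, q.2)) = η := by
  have hwn : Measurable (fun x => -w x) := hw.neg
  have : IsProbabilityMeasure (μ.map (fun x => -w x)) :=
    Measure.isProbabilityMeasure_map hwn.aemeasurable
  have : IsFiniteMeasure η := by
    constructor
    have : η univ = (η.map Prod.fst) univ := by
      rw [Measure.map_apply measurable_fst MeasurableSet.univ]; simp
    rw [this, hη]
    exact measure_lt_top _ _
  have hF : Measurable (fun q : Vec d × Vec d => (-w q.1, q.2)) := by fun_prop
  have hC : ∀ k, MeasurableSet {x | w x = k} := fun k => hw (measurableSet_singleton k)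
  have hfib : ∀ k, η ({-k} ×ˢ univ) = μ {x | w x = k} := by
    intro k
    have h1 := congrArg (fun m => m {-k}) hη
    rw [Measure.map_apply measurable_fst (measurableSet_singleton _),
      Measure.map_apply hwn (measurableSet_singleton _)] at h1
    convert h1 using 2
    · ext p; simp
    · ext p; simp
  constructor
  · rw [liftCoupling, ← Measure.mapₗ_apply_of_measurable measurable_fst, map_sum]
    conv_rhs => rw [← sum_restrict_fibers μ w hw T (by simp [hm])]
    refine Finset.sum_congr rfl fun k _ => ?_
    rw [Measure.mapₗ_apply_of_measurable measurable_fst, Measure.map_fst_prod,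
      Measure.map_apply measurable_snd MeasurableSet.univ]
    simp only [preimage_univ, Measure.restrict_apply_univ, hfib]
    change _ = μ.restrict {x | w x = k}
    by_cases h0 : μ {x | w x = k} = 0
    · rw [h0, zero_smul, Measure.restrict_eq_zero.2 h0]
    · rw [smul_smul, ENNReal.mul_inv_cancel h0 (measure_ne_top _ _), one_smul]
  · rw [liftCoupling, ← Measure.mapₗ_apply_of_measurable hF, map_sum]
    have hz : η {p | -p.1 ∉ T} = 0 := by
      have h1 := congrArg (fun m => m {y | -y ∉ T}) hη
      have hS : MeasurableSet {y : Vec d | -y ∉ T} :=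
        measurable_neg (T.measurableSet.compl)
      rw [Measure.map_apply measurable_fst hS, Measure.map_apply hwn hS] at h1
      refine h1.trans ?_
      simp [hm]
    conv_rhs => rw [← sum_restrict_fibers η (fun p => -p.1) (by fun_prop) T hz]
    refine Finset.sum_congr rfl fun k _ => ?_
    rw [Measure.mapₗ_apply_of_measurable hF]
    have hpre : (fun p : Vec d × Vec d => -p.1) ⁻¹' {k} = {-k} ×ˢ univ := by
      ext p; simp [neg_eq_iff_eq_neg]
    rw [hpre]
    by_cases h0 : μ {x | w x = k} = 0
    · rw [Measure.restrict_eq_zero.2 h0, Measure.restrict_eq_zero.2 ((hfib k).trans h0)]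
      simp
    have : IsFiniteMeasure ((μ {x | w x = k})⁻¹ • μ.restrict {x | w x = k}) :=
      Measure.smul_finite _ (ENNReal.inv_ne_top.2 h0)
    have := Measure.isFiniteMeasure_map (η.restrict ({-k} ×ˢ (univ : Set (Vec d)))) Prod.snd
    refine Measure.ext_prod (fun {s t} hs ht => ?_)
    have hp : (fun q : Vec d × Vec d => (-w q.1, q.2)) ⁻¹' (s ×ˢ t)
        = ((fun x => -w x) ⁻¹' s) ×ˢ t := rfl
    rw [Measure.map_apply hF (hs.prod ht), hp, Measure.prod_prod, Measure.smul_apply,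
      Measure.restrict_apply (hwn hs), Measure.map_apply measurable_snd ht,
      Measure.restrict_apply (measurable_snd ht), Measure.restrict_apply (hs.prod ht), smul_eq_mul]
    by_cases hk : -k ∈ s
    · have e1 : (fun x => -w x) ⁻¹' s ∩ {x | w x = k} = {x | w x = k} := by
        ext x
        simp only [mem_inter_iff, mem_preimage, mem_ofPred_eq, and_iff_right_iff_imp]
        rintro rfl; exact hk
      have e2 : Prod.snd ⁻¹' t ∩ {-k} ×ˢ univ = s ×ˢ t ∩ {-k} ×ˢ (univ : Set (Vec d)) := by
        ext ⟨a, b⟩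
        simp only [mem_inter_iff, mem_preimage, mem_prod, mem_singleton_iff, mem_univ, and_true]
        constructor
        · rintro ⟨hb, rfl⟩; exact ⟨⟨hk, hb⟩, rfl⟩
        · rintro ⟨⟨_, hb⟩, rfl⟩; exact ⟨hb, rfl⟩
      rw [e1, e2, ENNReal.inv_mul_cancel h0 (measure_ne_top _ _), one_mul]
    · have e1 : (fun x => -w x) ⁻¹' s ∩ {x | w x = k} = ∅ := by
        ext x
        simp only [mem_inter_iff, mem_preimage, mem_ofPred_eq, mem_empty_iff_false, iff_false]
        rintro ⟨h, rfl⟩; exact hk h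
      have e2 : s ×ˢ t ∩ {-k} ×ˢ (univ : Set (Vec d)) = ∅ := by
        ext ⟨a, b⟩
        simp only [mem_inter_iff, mem_prod, mem_singleton_iff, mem_univ, and_true,
          mem_empty_iff_false, iff_false]
        rintro ⟨⟨h, _⟩, rfl⟩; exact hk h
      rw [e1, e2]; simp

/-- **McCann interpolation in the reduced decision space: consistent lifts.** With
`α = (w̄*)_#μ`, an optimal quadratic-cost coupling `η* ∈ Γ(α,ν)`, `ν_t = (π_t)_#η*` and
`η_t = (Id,π_t)_#η*`: `α` is supported on `{−w_k}_k` with `α({−w_k}) = μ(C_k)`; the lift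
`γ_t` is a coupling of `μ` and `ν_t` and satisfies `(w̄* × Id)_#γ_t = η_t`; in particular
`(w̄* × Id)_#γ_1 = η*`. -/
theorem stmt17 {d : ℕ} (S : Set (Vec d)) (𝔖 : Finset (Vec d)) (wstar : Vec d → Vec d)
    (hSne : S.Nonempty) (hScomp : IsCompact S)
    (hext : (𝔖 : Set (Vec d)) = S.extremePoints ℝ)
    (hwmeas : Measurable wstar) (hwmem : ∀ x, wstar x ∈ 𝔖)
    (hwopt : ∀ x : Vec d, ∀ w ∈ S, ⟪wstar x, x⟫ ≤ ⟪w, x⟫)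
    (μ ν : Measure (Vec d)) [IsProbabilityMeasure μ] [IsProbabilityMeasure ν]
    (hμ2 : Integrable (fun x : Vec d => ‖x‖ ^ 2) μ)
    (hν2 : Integrable (fun y : Vec d => ‖y‖ ^ 2) ν)
    (ηstar : Measure (Vec d × Vec d))
    (hηstar : IsCoupling (μ.map (fun x => -wstar x)) ν ηstar)
    (hηopt : ∫ p, ‖p.1 - p.2‖ ^ 2 ∂ηstar = W2sq (μ.map (fun x => -wstar x)) ν) :
    ((μ.map (fun x => -wstar x)) (((fun w : Vec d => -w) '' (𝔖 : Set (Vec d)))ᶜ) = 0) ∧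
    (∀ wk ∈ 𝔖,
      (μ.map (fun x => -wstar x)) {-wk} = μ {x | wstar x = wk}) ∧
    (∀ t ∈ Set.Icc (0 : ℝ) 1,
      IsCoupling μ (ηstar.map (fun p => (1 - t) • p.1 + t • p.2))
        (liftCoupling 𝔖 wstar μ
          (ηstar.map (fun p => (p.1, (1 - t) • p.1 + t • p.2)))) ∧
      (liftCoupling 𝔖 wstar μ
          (ηstar.map (fun p => (p.1, (1 - t) • p.1 + t • p.2)))).map
          (fun q => (-wstar q.1, q.2)) =
        ηstar.map (fun p => (p.1, (1 - t) • p.1 + t • p.2))) ∧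
    (liftCoupling 𝔖 wstar μ
        (ηstar.map (fun p => (p.1, (1 - (1 : ℝ)) • p.1 + (1 : ℝ) • p.2)))).map
        (fun q => (-wstar q.1, q.2)) = ηstar := by
  have hwn : Measurable (fun x => -wstar x) := hwmeas.neg
  have key : ∀ t : ℝ, (ηstar.map (fun p => (p.1, (1 - t) • p.1 + t • p.2))).map Prod.fst
      = μ.map (fun x => -wstar x) := by
    intro t
    rw [Measure.map_map measurable_fst (by fun_prop)]
    exact hηstar.1
  refine ⟨?_, ?_, ?_, ?_⟩
  · rw [Measure.map_apply hwn (((𝔖.finite_toSet.image _).measurableSet).compl)]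
    convert measure_empty (μ := μ)
    ext x
    simp only [mem_preimage, mem_compl_iff, mem_empty_iff_false, iff_false, not_not]
    exact ⟨wstar x, hwmem x, rfl⟩
  · intro wk _
    rw [Measure.map_apply hwn (measurableSet_singleton _)]
    congr 1
    ext x; simp
  · intro t _
    obtain ⟨h1, h2⟩ := lift_props 𝔖 wstar hwmeas hwmem μ _ (key t)
    refine ⟨⟨h1, ?_⟩, h2⟩
    have h3 := congrArg (fun m => m.map Prod.snd) h2
    rw [Measure.map_map measurable_snd (by fun_prop),
      Measure.map_map measurable_snd (by fun_prop)] at h3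
    exact h3
  · rw [(lift_props 𝔖 wstar hwmeas hwmem μ _ (key 1)).2]
    simp
end
end

section
/- In the setting of the McCann interpolation in the reduced decision space with α := (w̄*)_#μ and ν_t := (π_t)_#η* for an optimal quadratic-cost coupling η* ∈ Γ(α,ν): fix t ∈ [0,1] and let η̃_t be any optimal coupling for the quadratic cost ‖a−y‖₂² between α and ν_t. Then the lifted coupling γ̃_t defined by γ̃_t(A,B) := Σ_{k=1}^{K} [μ(A ∩ C_k)/μ(C_k)] · η̃_t({−w_k} × B) is optimal for the optimistic DF distance between μ and ν_t, i.e. ∫ ℓ_SPO(x,y) dγ̃_t(x,y) = inf_{γ∈Γ(μ,ν_t)} ∫ ℓ_SPO(x,y) dγ(x,y) = W^O_DF(μ, ν_t). -/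
open MeasureTheory Set
open scoped RealInnerProductSpace ENNReal

noncomputable section

lemma aux_prob {d : ℕ} {P Q : Measure (Vec d)} [IsProbabilityMeasure P]
    {η : Measure (Vec d × Vec d)} (h : IsCoupling P Q η) : IsProbabilityMeasure η := by
  constructor
  have h1 : η.map Prod.fst univ = 1 := by rw [h.1]; exact measure_univ
  rwa [Measure.map_apply measurable_fst MeasurableSet.univ, preimage_univ] at h1

lemma aux_fst {d : ℕ} {P Q : Measure (Vec d)} {η : Measure (Vec d × Vec d)}
    (h : IsCoupling P Q η) (hP : MemLp id 2 P) : MemLp (fun p : Vec d × Vec d => p.1) 2 η := by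
  have h1 := h.1
  rw [← h1] at hP
  exact (memLp_map_measure_iff (f := Prod.fst) (g := id) (by fun_prop) (by fun_prop)).1 hP

lemma aux_snd {d : ℕ} {P Q : Measure (Vec d)} {η : Measure (Vec d × Vec d)}
    (h : IsCoupling P Q η) (hP : MemLp id 2 Q) : MemLp (fun p : Vec d × Vec d => p.2) 2 η := by
  have h1 := h.2
  rw [← h1] at hP
  exact (memLp_map_measure_iff (f := Prod.snd) (g := id) (by fun_prop) (by fun_prop)).1 hP

lemma aux_inner {d : ℕ} {Ω : Type*} [MeasurableSpace Ω] {m : Measure Ω} {f g : Ω → Vec d}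
    (hf : MemLp f 2 m) (hg : MemLp g 2 m) : Integrable (fun p => ⟪f p, g p⟫) m := by
  refine Integrable.mono' ((hf.norm.integrable_mul hg.norm))
    (hf.aestronglyMeasurable.inner hg.aestronglyMeasurable) ?_
  filter_upwards with p
  exact norm_inner_le_norm _ _

/-- Expansion of the quadratic cost. -/
lemma aux_quad {d : ℕ} {P Q : Measure (Vec d)} {η : Measure (Vec d × Vec d)}
    (h : IsCoupling P Q η) (hP : MemLp id 2 P) (hQ : MemLp id 2 Q) :
    ∫ p, ‖p.1 - p.2‖ ^ 2 ∂η =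
      ∫ a, ‖a‖ ^ 2 ∂P + ∫ y, ‖y‖ ^ 2 ∂Q - 2 * ∫ p, ⟪p.1, p.2⟫ ∂η := by
  have h1 := aux_fst h hP
  have h2 := aux_snd h hQ
  have e1 : ∫ a, ‖a‖ ^ 2 ∂P = ∫ p, ‖p.1‖ ^ 2 ∂η := by
    rw [← h.1, integral_map (by fun_prop) (by fun_prop)]
  have e2 : ∫ a, ‖a‖ ^ 2 ∂Q = ∫ p, ‖p.2‖ ^ 2 ∂η := by
    rw [← h.2, integral_map (by fun_prop) (by fun_prop)]
  have i1 : Integrable (fun p : Vec d × Vec d => ‖p.1‖ ^ 2) η :=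
    (memLp_two_iff_integrable_sq_norm h1.1).1 h1
  have i2 : Integrable (fun p : Vec d × Vec d => ‖p.2‖ ^ 2) η :=
    (memLp_two_iff_integrable_sq_norm h2.1).1 h2
  have i3 := aux_inner h1 h2
  rw [e1, e2, ← integral_const_mul, ← integral_add i1 i2,
    ← integral_sub (f := fun p : Vec d × Vec d => ‖p.1‖ ^ 2 + ‖p.2‖ ^ 2)
      (i1.add i2) (i3.const_mul 2)]
  congr 1
  ext p
  rw [norm_sub_sq_real]
  ring

/-- SPO cost in terms of the projected coupling. -/
lemma aux_spo {d : ℕ} {wstar : Vec d → Vec d} (hw : Measurable wstar) {C : ℝ}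
    (hC : ∀ x, ‖wstar x‖ ≤ C) {μ ρ : Measure (Vec d)} [IsProbabilityMeasure μ]
    [IsProbabilityMeasure ρ] (hρ : MemLp id 2 ρ) {γ : Measure (Vec d × Vec d)}
    (h : IsCoupling μ ρ γ) :
    ∫ p, spoLoss wstar p.1 p.2 ∂γ =
      - ∫ p, ⟪p.1, p.2⟫ ∂(γ.map (fun p => (-wstar p.1, p.2))) - ∫ y, ⟪y, wstar y⟫ ∂ρ := by
  have := aux_prob h
  have h2 := aux_snd h hρ
  have m1 : MemLp (fun p : Vec d × Vec d => wstar p.1) 2 γ :=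
    MemLp.of_bound (hw.comp measurable_fst).aestronglyMeasurable C (Filter.Eventually.of_forall fun p => hC _)
  have m2 : MemLp (fun p : Vec d × Vec d => wstar p.2) 2 γ :=
    MemLp.of_bound (hw.comp measurable_snd).aestronglyMeasurable C (Filter.Eventually.of_forall fun p => hC _)
  have hm : Measurable (fun y : Vec d => ⟪y, wstar y⟫) := measurable_id.inner hw
  have e2 : ∫ y, ⟪y, wstar y⟫ ∂ρ = ∫ p, ⟪p.2, wstar p.2⟫ ∂γ := by
    rw [← h.2, integral_map (by fun_prop) hm.aestronglyMeasurable]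
  rw [e2, integral_map (by fun_prop) (by fun_prop), ← integral_neg]
  unfold spoLoss
  rw [integral_sub (aux_inner h2 m1) (aux_inner h2 m2)]
  congr 2
  ext p
  simp [real_inner_comm]

lemma aux_proj {d : ℕ} {wstar : Vec d → Vec d} (hw : Measurable wstar)
    {μ ρ : Measure (Vec d)} {γ : Measure (Vec d × Vec d)} (h : IsCoupling μ ρ γ) :
    IsCoupling (μ.map (fun x => -wstar x)) ρ (γ.map (fun p => (-wstar p.1, p.2))) := by
  constructor
  · rw [Measure.map_map (by fun_prop) (by fun_prop), ← h.1,
      Measure.map_map (by fun_prop) (by fun_prop)]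
    rfl
  · rw [Measure.map_map (by fun_prop) (by fun_prop), ← h.2]
    rfl

lemma aux_slice {d : ℕ} (η : Measure (Vec d × Vec d)) [IsFiniteMeasure η] (a : Vec d) :
    (Measure.dirac a).prod ((η.restrict ({a} ×ˢ (univ : Set (Vec d)))).map Prod.snd) =
      η.restrict ({a} ×ˢ (univ : Set (Vec d))) := by
  rw [Measure.dirac_prod, Measure.map_map (by fun_prop) (by fun_prop)]
  have hs : MeasurableSet ({a} ×ˢ (univ : Set (Vec d)) : Set (Vec d × Vec d)) :=
    (measurableSet_singleton a).prod MeasurableSet.univ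
  conv_rhs => rw [← Measure.map_id (μ := η.restrict ({a} ×ˢ (univ : Set (Vec d))))]
  refine Measure.map_congr ?_
  filter_upwards [ae_restrict_mem hs] with p hp
  have : p.1 = a := by simpa using hp
  ext1 <;> simp [this]

lemma aux_fibre {d : ℕ} {wstar : Vec d → Vec d} (hw : Measurable wstar)
    {μ ρ : Measure (Vec d)} {η : Measure (Vec d × Vec d)}
    (h : IsCoupling (μ.map (fun x => -wstar x)) ρ η) (wk : Vec d) :
    η ({-wk} ×ˢ (univ : Set (Vec d))) = μ {x | wstar x = wk} := by
  have h1 := DFunLike.congr_fun h.1 ({-wk})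
  rw [Measure.map_apply measurable_fst (measurableSet_singleton _),
    Measure.map_apply (by fun_prop) (measurableSet_singleton _)] at h1
  convert h1 using 2
  · ext p; simp
  · ext p; simp

lemma aux_sum {d : ℕ} {m : Measure (Vec d × Vec d)} (𝔖 : Finset (Vec d))
    (s : Vec d → Set (Vec d × Vec d)) (hs : ∀ k, MeasurableSet (s k))
    (hd : ∀ i j, i ≠ j → Disjoint (s i) (s j)) (hu : m (⋃ k ∈ 𝔖, s k)ᶜ = 0) :
    ∑ k ∈ 𝔖, m.restrict (s k) = m := by
  have hU : MeasurableSet (⋃ k ∈ 𝔖, s k) := Finset.measurableSet_biUnion _ fun k _ => hs k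
  ext E hE
  rw [Measure.finsetSum_apply]
  simp only [Measure.restrict_apply hE]
  rw [← measure_biUnion_finset (fun i _ j _ hij => (hd i j hij).mono inter_subset_right inter_subset_right)
    (fun k _ => hE.inter (hs k)), ← inter_iUnion₂]
  exact measure_inter_conull hu

/-- Projecting the lift recovers the coupling. -/
lemma aux_lift_proj {d : ℕ} {wstar : Vec d → Vec d} (hw : Measurable wstar)
    (𝔖 : Finset (Vec d)) (hwmem : ∀ x, wstar x ∈ 𝔖)
    {μ ρ : Measure (Vec d)} [IsProbabilityMeasure μ] {η : Measure (Vec d × Vec d)}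
    [IsFiniteMeasure η] (h : IsCoupling (μ.map (fun x => -wstar x)) ρ η) :
    (liftCoupling 𝔖 wstar μ η).map (fun p => (-wstar p.1, p.2)) = η := by
  have hC : ∀ wk, MeasurableSet {x | wstar x = wk} := fun wk => hw (measurableSet_singleton wk)
  have hT : Measurable (fun p : Vec d × Vec d => (-wstar p.1, p.2)) := by fun_prop
  have hs : ∀ wk : Vec d,
      MeasurableSet ({-wk} ×ˢ (univ : Set (Vec d)) : Set (Vec d × Vec d)) := fun wk =>
    (measurableSet_singleton _).prod MeasurableSet.univ
  unfold liftCoupling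
  rw [← Measure.mapₗ_apply_of_measurable hT, map_sum]
  simp only [Measure.mapₗ_apply_of_measurable hT]
  refine Eq.trans (Finset.sum_congr rfl (g := fun wk => η.restrict ({-wk} ×ˢ univ)) ?_)
    (aux_sum 𝔖 _ hs ?_ ?_)
  · intro wk _
    have hf := aux_fibre hw h wk
    by_cases h0 : μ {x | wstar x = wk} = 0
    · rw [h0] at hf
      rw [Measure.restrict_eq_zero.2 hf, Measure.restrict_eq_zero.2 h0]
      simp
    · have e : (fun p : Vec d × Vec d => (-wstar p.1, p.2)) =
        Prod.map (fun x => -wstar x) id := rfl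
      have : IsFiniteMeasure ((μ {x | wstar x = wk})⁻¹ • μ.restrict {x | wstar x = wk}) :=
        Measure.smul_finite _ (ENNReal.inv_ne_top.2 h0)
      rw [e, ← Measure.map_prod_map _ _ (by fun_prop) measurable_id, Measure.map_id]
      have e2 : ((μ {x | wstar x = wk})⁻¹ • μ.restrict {x | wstar x = wk}).map
          (fun x => -wstar x) = Measure.dirac (-wk) := by
        have : (fun x => -wstar x) =ᵐ[(μ {x | wstar x = wk})⁻¹ • μ.restrict {x | wstar x = wk}]
            fun _ => -wk := by
          refine Measure.ae_smul_measure ?_ _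
          filter_upwards [ae_restrict_mem (hC wk)] with x hx
          have hx' : wstar x = wk := hx
          rw [hx']
        rw [Measure.map_congr this, Measure.map_const]
        simp [ENNReal.inv_mul_cancel h0 (measure_ne_top _ _)]
      rw [e2, aux_slice]
  · intro i j hij
    rw [Set.disjoint_left]
    rintro p hp hq
    apply hij
    have h1 : p.1 = -i := by simpa using hp
    have h2 : p.1 = -j := by simpa using hq
    exact neg_injective (h1.symm.trans h2)
  · have hm : MeasurableSet (⋃ k ∈ 𝔖, {-k} : Set (Vec d)) :=
      Finset.measurableSet_biUnion _ fun k _ => measurableSet_singleton _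
    have h1 := DFunLike.congr_fun h.1 ((⋃ k ∈ 𝔖, {-k})ᶜ)
    rw [Measure.map_apply measurable_fst hm.compl, Measure.map_apply (by fun_prop) hm.compl] at h1
    have e : (fun x => -wstar x) ⁻¹' (⋃ k ∈ 𝔖, {-k})ᶜ = ∅ := by
      ext x
      simp [hwmem x]
    rw [e, measure_empty] at h1
    rw [← h1]
    congr 1
    ext p
    simp

lemma aux_lift {d : ℕ} {wstar : Vec d → Vec d} (hw : Measurable wstar)
    (𝔖 : Finset (Vec d)) (hwmem : ∀ x, wstar x ∈ 𝔖)
    {μ ρ : Measure (Vec d)} [IsProbabilityMeasure μ] {η : Measure (Vec d × Vec d)}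
    [IsFiniteMeasure η] (h : IsCoupling (μ.map (fun x => -wstar x)) ρ η) :
    IsCoupling μ ρ (liftCoupling 𝔖 wstar μ η) := by
  have hC : ∀ wk, MeasurableSet {x | wstar x = wk} := fun wk => hw (measurableSet_singleton wk)
  constructor
  · unfold liftCoupling
    ext A hA
    rw [Measure.map_apply measurable_fst hA, Measure.finsetSum_apply]
    have e : (Prod.fst ⁻¹' A : Set (Vec d × Vec d)) = A ×ˢ univ := by ext; simp
    rw [e]
    have : ∀ wk ∈ 𝔖, (((μ {x | wstar x = wk})⁻¹ • μ.restrict {x | wstar x = wk}).prod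
      ((η.restrict ({-wk} ×ˢ (univ : Set (Vec d)))).map Prod.snd)) (A ×ˢ univ) =
        μ (A ∩ {x | wstar x = wk}) := by
      intro wk _
      rw [Measure.prod_prod, Measure.map_apply measurable_snd MeasurableSet.univ, preimage_univ,
        Measure.restrict_apply_univ, aux_fibre hw h, Measure.smul_apply, smul_eq_mul,
        Measure.restrict_apply hA]
      by_cases h0 : μ {x | wstar x = wk} = 0
      · rw [h0, mul_zero, measure_mono_null inter_subset_right h0]
      · rw [mul_right_comm, ENNReal.inv_mul_cancel h0 (measure_ne_top _ _), one_mul]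
    rw [Finset.sum_congr rfl this, ← measure_biUnion_finset _ (fun k _ => hA.inter (hC k))]
    · congr 1
      ext x
      simp [hwmem x]
    · intro i _ j _ hij
      rw [Function.onFun, Set.disjoint_left]
      rintro p hp hq
      exact hij (hp.2.symm.trans hq.2)
  · have := congrArg (Measure.map Prod.snd) (aux_lift_proj hw 𝔖 hwmem h)
    rw [h.2, Measure.map_map (by fun_prop) (by fun_prop)] at this
    exact this

/-- **Per-time optimality of lifted couplings along the reduced-space McCann
interpolation.** With `α = (w̄*)_#μ`, `η* ∈ Γ(α,ν)` optimal for the quadratic cost, and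
`ν_t = (π_t)_#η*`: for fixed `t ∈ [0,1]`, if `η̃_t` is any optimal quadratic-cost coupling
between `α` and `ν_t`, then its lift `γ̃_t` attains the optimistic DF distance:
`∫ ℓ_SPO dγ̃_t = W^O_DF(μ, ν_t)`. -/
theorem stmt18 {d : ℕ} (S : Set (Vec d)) (𝔖 : Finset (Vec d)) (wstar : Vec d → Vec d)
    (hSne : S.Nonempty) (hScomp : IsCompact S)
    (hext : (𝔖 : Set (Vec d)) = S.extremePoints ℝ)
    (hwmeas : Measurable wstar) (hwmem : ∀ x, wstar x ∈ 𝔖)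
    (hwopt : ∀ x : Vec d, ∀ w ∈ S, ⟪wstar x, x⟫ ≤ ⟪w, x⟫)
    (μ ν : Measure (Vec d)) [IsProbabilityMeasure μ] [IsProbabilityMeasure ν]
    (hμ2 : Integrable (fun x : Vec d => ‖x‖ ^ 2) μ)
    (hν2 : Integrable (fun y : Vec d => ‖y‖ ^ 2) ν)
    (ηstar : Measure (Vec d × Vec d))
    (hηstar : IsCoupling (μ.map (fun x => -wstar x)) ν ηstar)
    (hηopt : ∫ p, ‖p.1 - p.2‖ ^ 2 ∂ηstar = W2sq (μ.map (fun x => -wstar x)) ν)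
    (t : ℝ) (ht : t ∈ Set.Icc (0 : ℝ) 1)
    (ηt : Measure (Vec d × Vec d))
    (hηt : IsCoupling (μ.map (fun x => -wstar x))
      (ηstar.map (fun p => (1 - t) • p.1 + t • p.2)) ηt)
    (hηtopt : ∫ p, ‖p.1 - p.2‖ ^ 2 ∂ηt =
      W2sq (μ.map (fun x => -wstar x)) (ηstar.map (fun p => (1 - t) • p.1 + t • p.2))) :
    ∫ p, spoLoss wstar p.1 p.2 ∂(liftCoupling 𝔖 wstar μ ηt) =
      WDFO wstar μ (ηstar.map (fun p => (1 - t) • p.1 + t • p.2)) := by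
  obtain ⟨C, hC⟩ : ∃ C, ∀ x, ‖wstar x‖ ≤ C :=
    ⟨∑ w ∈ 𝔖, ‖w‖, fun x =>
      Finset.single_le_sum (f := fun w => ‖w‖) (fun _ _ => norm_nonneg _) (hwmem x)⟩
  have pα : IsProbabilityMeasure (μ.map (fun x => -wstar x)) :=
    Measure.isProbabilityMeasure_map (by fun_prop)
  have hα : MemLp id 2 (μ.map (fun x => -wstar x)) := by
    rw [memLp_map_measure_iff (by fun_prop) (by fun_prop)]
    exact MemLp.of_bound (by fun_prop) C
      (Filter.Eventually.of_forall fun p => by simpa using hC p)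
  have hν : MemLp id 2 ν := (memLp_two_iff_integrable_sq_norm (by fun_prop)).2 hν2
  have pη := aux_prob hηstar
  have hρ : MemLp id 2 (ηstar.map (fun p => (1 - t) • p.1 + t • p.2)) := by
    rw [memLp_map_measure_iff (by fun_prop) (by fun_prop)]
    exact ((aux_fst hηstar hα).const_smul (1 - t)).add ((aux_snd hηstar hν).const_smul t)
  have pρ : IsProbabilityMeasure (ηstar.map (fun p => (1 - t) • p.1 + t • p.2)) :=
    Measure.isProbabilityMeasure_map (by fun_prop)
  have pηt := aux_prob hηt
  generalize ηstar.map (fun p => (1 - t) • p.1 + t • p.2) = ρ at *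
  have hL := aux_lift hwmeas 𝔖 hwmem hηt
  unfold WDFO
  symm
  refine IsLeast.csInf_eq ⟨⟨_, hL, rfl⟩, ?_⟩
  rintro r ⟨γ, hγ, rfl⟩
  rw [aux_spo hwmeas hC hρ hL, aux_spo hwmeas hC hρ hγ, aux_lift_proj hwmeas 𝔖 hwmem hηt]
  have hp := aux_proj hwmeas hγ
  have q1 := aux_quad hηt hα hρ
  have q2 := aux_quad hp hα hρ
  have hle : W2sq (μ.map (fun x => -wstar x)) ρ ≤
      ∫ p, ‖p.1 - p.2‖ ^ 2 ∂(γ.map (fun p => (-wstar p.1, p.2))) := by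
    refine csInf_le ⟨0, ?_⟩ ⟨_, hp, rfl⟩
    rintro r ⟨π, _, rfl⟩
    exact integral_nonneg fun p => by positivity
  linarith
end
end
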